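/- arXiv:hep-th/0407113 — 2 statements merged into one kernel-verified Lean document; each statement's English description precedes it below -/
import Mathlib

section
/- For every n ≥ 0 and every ω ∈ Ωⁿ one has (n+1)·L(iⁿω) = −i^{n+1}(dω). In particular, if dω = 0 then the element iⁿω ∈ Ω⁰ is annihilated by L (closed n-forms give L-cocycles). -/
noncomputable section

/-- The iterated contraction `iⁿ : Ωⁿ → Ω⁰`. -/
def iterContr (Ω : ℤ → Type*) [∀ k, AddCommGroup (Ω k)] [∀ k, Module ℝ (Ω k)]
    (i : ∀ k : ℤ, Ω (k + 1) →ₗ[ℝ] Ω k) : ∀ n : ℕ, Ω (n : ℤ) →ₗ[ℝ] Ω (0 : ℤ)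
  | 0 => LinearMap.id
  | n + 1 => (iterContr Ω i n) ∘ₗ (i (n : ℤ))

/-- An operator commuting with the contraction commutes with its iterates. -/
theorem iterContr_comm (Ω : ℤ → Type*) [∀ k, AddCommGroup (Ω k)] [∀ k, Module ℝ (Ω k)]
    (i : ∀ k : ℤ, Ω (k + 1) →ₗ[ℝ] Ω k) (L : ∀ k : ℤ, Ω k →ₗ[ℝ] Ω k)
    (hLi : ∀ (k : ℤ) (x : Ω (k + 1)), L k (i k x) = i k (L (k + 1) x)) :
    ∀ (n : ℕ) (x : Ω (n : ℤ)), L 0 (iterContr Ω i n x) = iterContr Ω i n (L n x)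
  | 0, _ => rfl
  | n + 1, x => (iterContr_comm Ω i L hLi n (i n x)).trans
      (congrArg (iterContr Ω i n) (hLi n x))

/-- **Statement 10.** Let `(Ωᵏ)_{k∈ℤ}` be real vector spaces with `Ωᵏ = 0` for `k < 0`,
with maps `d : Ωᵏ → Ω^{k+1}`, `i : Ωᵏ → Ω^{k−1}`, and `L = d∘i − i∘d`, assuming
`L∘i = i∘L`. Then for every `n ≥ 0` and `ω ∈ Ωⁿ` one has
`(n+1)·L(iⁿω) = −i^{n+1}(dω)`; in particular if `dω = 0` then `L(iⁿω) = 0`. -/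
theorem closed_forms_give_L_cocycles
    (Ω : ℤ → Type*) [∀ k, AddCommGroup (Ω k)] [∀ k, Module ℝ (Ω k)]
    (hzero : ∀ k : ℤ, k < 0 → ∀ x : Ω k, x = 0)
    (d : ∀ k : ℤ, Ω k →ₗ[ℝ] Ω (k + 1)) (i : ∀ k : ℤ, Ω (k + 1) →ₗ[ℝ] Ω k)
    (L : ∀ k : ℤ, Ω k →ₗ[ℝ] Ω k)
    (hL : ∀ (k : ℤ) (x : Ω (k + 1)), L (k + 1) x = d k (i k x) - i (k + 1) (d (k + 1) x))
    (hLi : ∀ (k : ℤ) (x : Ω (k + 1)), L k (i k x) = i k (L (k + 1) x)) :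
    ∀ (n : ℕ) (ω : Ω (n : ℤ)),
      ((n : ℝ) + 1) • L 0 (iterContr Ω i n ω) = - iterContr Ω i (n + 1) (d (n : ℤ) ω) ∧
      (d (n : ℤ) ω = 0 → L 0 (iterContr Ω i n ω) = 0) := by
  have key : ∀ (n : ℕ) (ω : Ω (n : ℤ)),
      ((n : ℝ) + 1) • L 0 (iterContr Ω i n ω) = - iterContr Ω i (n + 1) (d (n : ℤ) ω) := by
    intro n
    induction n with
    | zero =>
      intro ω
      have h : ∀ k m : ℤ, k = m + 1 → m < 0 → ∀ x : Ω k, L k x = - i k (d k x) := by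
        rintro _ m rfl hm x
        rw [hL, hzero m hm (i m x), map_zero, zero_sub]
      rw [Nat.cast_zero, zero_add, one_smul]
      exact h 0 (-1) (by norm_num) (by norm_num) ω
    | succ n ih =>
      intro ω
      have h₁ := ih (i n ω)
      have h₂ : d n (i n ω) = L (n + 1 : ℤ) ω + i (n + 1) (d (n + 1) ω) :=
        (sub_eq_iff_eq_add.mp (hL n ω).symm)
      have h₃ : iterContr Ω i (n + 1) (L (n + 1 : ℤ) ω) = L 0 (iterContr Ω i n (i n ω)) :=
        (iterContr_comm Ω i L hLi (n + 1) ω).symm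
      have h₄ : iterContr Ω i (n + 1) (d n (i n ω)) =
          L 0 (iterContr Ω i n (i n ω)) + iterContr Ω i (n + 1) (i (n + 1) (d (n + 1) ω)) := by
        rw [← h₃, h₂]
        exact map_add (iterContr Ω i (n + 1)) _ _
      have h₅ : ((n : ℝ) + 1 + 1) • L 0 (iterContr Ω i n (i n ω)) =
          - iterContr Ω i (n + 1) (i (n + 1) (d (n + 1) ω)) := by
        rw [add_smul, one_smul, h₁, h₄]
        abel
      rw [Nat.cast_succ]
      exact h₅
  intro n ω
  refine ⟨key n ω, fun hω => ?_⟩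
  have h := key n ω
  rw [hω] at h
  have h_zero : ((n : ℝ) + 1) • L 0 (iterContr Ω i n ω) = 0 :=
    h.trans (by rw [neg_eq_zero]; exact map_zero (iterContr Ω i (n + 1)))
  exact (smul_eq_zero.mp h_zero).resolve_left (by positivity)
end
end

section
/- The form c_n is alternating and is a Chevalley–Eilenberg cocycle of the Lie algebra L: for all x₁, …, x_{2n} ∈ L, Σ_{1 ≤ i < j ≤ 2n} (−1)^{i+j} c_n(⁅x_i, x_j⁆, x₁, …, x̂_i, …, x̂_j, …, x_{2n}) = 0, where hats denote omitted arguments. (These are the primitive elements tr(ad_{i₁}⋯ad_{i_{2n−1}}) C^{i₁}⋯C^{i_{2n−1}} of the Lie algebra cohomology, i.e. the cocycles 𝒞_n = str(Λ^{2n−1}) of the principal series evaluated in the Chevalley–Eilenberg model.) -/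
open scoped BigOperators

/-- The multilinear form
`c_n(x₁,…,x_{2n−1}) = Σ_{σ ∈ S_{2n−1}} sgn(σ) · tr(ad x_{σ(1)} ∘ ⋯ ∘ ad x_{σ(2n−1)})`. -/
noncomputable def cForm (K : Type*) [Field K] (L : Type*) [LieRing L] [LieAlgebra K L]
    (n : ℕ) (x : Fin (2 * n - 1) → L) : K :=
  ∑ σ : Equiv.Perm (Fin (2 * n - 1)),
    ((Equiv.Perm.sign σ : ℤ) : K) *
      LinearMap.trace K L ((List.ofFn fun i => (LieAlgebra.ad K L (x (σ i)) : Module.End K L)).prod)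

theorem lie_prod_ofFn {A : Type*} [Ring A] (y : A) {m : ℕ} (a : Fin m → A) :
    ⁅y, (List.ofFn a).prod⁆ = ∑ j, (List.ofFn (Function.update a j ⁅y, a j⁆)).prod := by
  induction m with
  | zero => simp [Ring.lie_def]
  | succ m ih =>
    have h (j : Fin m) :
        (List.ofFn (Function.update a j.succ ⁅y, a j.succ⁆)).prod =
          a 0 * (List.ofFn (Function.update (fun i => a i.succ) j ⁅y, a j.succ⁆)).prod := by
      rw [List.ofFn_succ, List.prod_cons, Function.update_of_ne (Fin.succ_ne_zero j).symm]
      congr 3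
      exact Function.update_comp_eq_of_injective a (Fin.succ_injective m) j _
    have h0 : (List.ofFn (Function.update a 0 ⁅y, a 0⁆)).prod =
        ⁅y, a 0⁆ * (List.ofFn fun i : Fin m => a i.succ).prod := by
      simp [List.ofFn_succ]
    rw [Fin.sum_univ_succ, h0, Finset.sum_congr rfl fun j _ => h j, ← Finset.mul_sum, ← ih,
      List.ofFn_succ, List.prod_cons]
    simp only [Ring.lie_def]
    noncomm_ring

section AdTrace

variable (K L : Type*) [Field K] [LieRing L] [LieAlgebra K L]

/-- The multilinear form `(x₁, …, xₘ) ↦ tr (ad x₁ ∘ ⋯ ∘ ad xₘ)`. -/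
noncomputable def adTraceForm (m : ℕ) : MultilinearMap K (fun _ : Fin m => L) K :=
  (LinearMap.trace K L).compMultilinearMap
    ((MultilinearMap.mkPiAlgebraFin K m (Module.End K L)).compLinearMap
      fun _ => (LieAlgebra.ad K L : L →ₗ[K] Module.End K L))

theorem adTraceForm_apply {m : ℕ} (x : Fin m → L) :
    adTraceForm K L m x =
      LinearMap.trace K L (List.ofFn fun i => (LieAlgebra.ad K L (x i) : Module.End K L)).prod := by
  simp [adTraceForm]

theorem sum_adTraceForm_update_lie {m : ℕ} (y : L) (z : Fin m → L) :
    ∑ j, adTraceForm K L m (Function.update z j ⁅y, z j⁆) = 0 := by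
  have h (j : Fin m) :
      (fun i => (LieAlgebra.ad K L (Function.update z j ⁅y, z j⁆ i) : Module.End K L)) =
        Function.update (fun i => (LieAlgebra.ad K L (z i) : Module.End K L)) j
          ⁅(LieAlgebra.ad K L y : Module.End K L), LieAlgebra.ad K L (z j)⁆ := by
    funext i
    rcases eq_or_ne i j with rfl | hij
    · simp
    · simp [hij]
  simp only [adTraceForm_apply, h]
  rw [← map_sum, ← lie_prod_ofFn, LinearMap.trace_lie]

theorem sum_alternatization_adTraceForm_update_lie {m : ℕ} (y : L) (z : Fin m → L) :
    ∑ j, MultilinearMap.alternatization (adTraceForm K L m) (Function.update z j ⁅y, z j⁆) = 0 := by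
  simp only [MultilinearMap.alternatization_apply, MultilinearMap.domDomCongr_apply]
  rw [Finset.sum_comm]
  refine Finset.sum_eq_zero fun σ _ => ?_
  rw [← Finset.smul_sum, ← Equiv.sum_comp σ]
  have h (j : Fin m) : (fun i => Function.update z (σ j) ⁅y, z (σ j)⁆ (σ i)) =
      Function.update (fun i => z (σ i)) j ⁅y, z (σ j)⁆ :=
    Function.update_comp_eq_of_injective z σ.injective j _
  simp only [h, sum_adTraceForm_update_lie K L y fun i => z (σ i), smul_zero]

theorem cForm_eq_alternatization (n : ℕ) (x : Fin (2 * n - 1) → L) :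
    cForm K L n x = MultilinearMap.alternatization (adTraceForm K L (2 * n - 1)) x := by
  simp [cForm, MultilinearMap.alternatization_apply, adTraceForm_apply, Units.smul_def]

end AdTrace

theorem Fin.val_succAbove_eq_ite {n : ℕ} (p : Fin (n + 1)) (j : Fin n) :
    (p.succAbove j : ℕ) = if (j : ℕ) < p then (j : ℕ) else j + 1 := by
  simp only [Fin.succAbove, Fin.lt_def]
  split_ifs <;> simp_all

theorem getD_eraseIdx_eraseIdx_ofFn {α : Type*} {r : ℕ} (x : Fin (r + 2) → α) (d : α)
    (p : Fin (r + 2)) (j : Fin (r + 1)) (k : Fin r) :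
    (((List.ofFn x).eraseIdx (max (p : ℕ) (p.succAbove j))).eraseIdx
      (min (p : ℕ) (p.succAbove j))).getD k d = x (p.succAbove (j.succAbove k)) := by
  have key : (((List.ofFn x).eraseIdx (max (p : ℕ) (p.succAbove j))).eraseIdx
      (min (p : ℕ) (p.succAbove j)))[(k : ℕ)]? =
      (List.ofFn x)[((p.succAbove (j.succAbove k) : Fin (r + 2)) : ℕ)]? := by
    rw [List.getElem?_eraseIdx, List.getElem?_eraseIdx, List.getElem?_eraseIdx]
    rw [Fin.val_succAbove_eq_ite p j, Fin.val_succAbove_eq_ite p (j.succAbove k),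
      Fin.val_succAbove_eq_ite j k]
    split_ifs <;> first | rfl | omega
  rw [List.getD_eq_getElem?_getD, key, List.getElem?_ofFn]
  simp

/-- Evaluation of a form at `(⁅x_p, x_q⁆, x₁, …, x̂_p, …, x̂_q, …)` for an invariant alternating
form: the signed sum over `p < q` vanishes. -/
theorem AlternatingMap.sum_lie_eraseIdx_eq_zero {K L : Type*} [Field K] [CharZero K] [LieRing L]
    [LieAlgebra K L] {r : ℕ} (T : L [⋀^Fin (r + 1)]→ₗ[K] K)
    (hT : ∀ (y : L) (z : Fin (r + 1) → L), ∑ j, T (Function.update z j ⁅y, z j⁆) = 0)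
    (x : Fin (r + 2) → L) :
    (∑ i : Fin (r + 2), ∑ j : Fin (r + 2),
      if (i : ℕ) < (j : ℕ) then
        (-1 : K) ^ ((i : ℕ) + (j : ℕ)) *
          T (fun k =>
            (⁅x i, x j⁆ :: (((List.ofFn x).eraseIdx (j : ℕ)).eraseIdx (i : ℕ))).getD (k : ℕ) 0)
      else 0) = 0 := by
  set E : Fin (r + 2) → Fin (r + 2) → K := fun p q => (-1 : K) ^ ((p : ℕ) + (q : ℕ)) *
    T (Matrix.vecCons ⁅x p, x q⁆ fun k : Fin r =>
      (((List.ofFn x).eraseIdx (max (p : ℕ) q)).eraseIdx (min (p : ℕ) q)).getD k 0) with hE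
  have hswap (p q : Fin (r + 2)) : E q p = -E p q := by
    simp only [hE]
    rw [← lie_skew (x q) (x p), add_comm (q : ℕ), max_comm (q : ℕ), min_comm (q : ℕ),
      ← neg_one_smul K ⁅x p, x q⁆, AlternatingMap.map_vecCons_smul]
    simp
  have hinv (p : Fin (r + 2)) :
      ∑ q : Fin (r + 2), (if (q : ℕ) < p then E p q else if (p : ℕ) < q then -E p q else 0) = 0 := by
    rw [Fin.sum_univ_succAbove _ p]
    have h (j : Fin (r + 1)) :
        (if ((p.succAbove j : Fin (r + 2)) : ℕ) < p then E p (p.succAbove j)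
          else if (p : ℕ) < (p.succAbove j : Fin (r + 2)) then -E p (p.succAbove j) else 0) =
        (-1) ^ (p : ℕ) *
          T (Function.update (p.removeNth x) j ⁅x p, p.removeNth x j⁆) := by
      rw [← Fin.insertNth_removeNth, AlternatingMap.map_insertNth]
      simp only [hE, getD_eraseIdx_eraseIdx_ofFn]
      change _ = (-1) ^ (p : ℕ) * ((-1) ^ (j : ℕ) • T (Matrix.vecCons ⁅x p, x (p.succAbove j)⁆
        fun k => x (p.succAbove (j.succAbove k))))
      generalize T _ = t
      rw [Fin.val_succAbove_eq_ite]
      by_cases hjp : (j : ℕ) < p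
      · simp [hjp, pow_add, mul_assoc]
      · rw [if_neg hjp, if_neg (by omega), if_pos (by omega)]
        simp [pow_add, mul_assoc]
    rw [Finset.sum_congr rfl fun j _ => h j, ← Finset.mul_sum, hT]
    simp
  have hgoal (i j : Fin (r + 2)) (hij : (i : ℕ) < j) :
      (-1 : K) ^ ((i : ℕ) + (j : ℕ)) * T (fun k =>
        (⁅x i, x j⁆ :: (((List.ofFn x).eraseIdx (j : ℕ)).eraseIdx (i : ℕ))).getD (k : ℕ) 0) =
      E i j := by
    simp only [hE]
    rw [max_eq_right hij.le, min_eq_left hij.le]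
    congr 2
    funext k
    cases k using Fin.cases <;> simp
  have hlt : (∑ i : Fin (r + 2), ∑ j : Fin (r + 2), if (i : ℕ) < j then E i j else 0) = 0 := by
    set S := ∑ i : Fin (r + 2), ∑ j : Fin (r + 2), if (i : ℕ) < j then E i j else 0 with hS
    have hS' : (∑ i : Fin (r + 2), ∑ j : Fin (r + 2), if (j : ℕ) < i then E i j else 0) = -S := by
      rw [Finset.sum_comm, hS, ← Finset.sum_neg_distrib]
      refine Finset.sum_congr rfl fun i _ => ?_
      rw [← Finset.sum_neg_distrib]
      refine Finset.sum_congr rfl fun j _ => ?_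
      rw [hswap]
      split_ifs <;> simp
    have h0 : -S - S = 0 := by
      rw [← hS', hS, ← Finset.sum_sub_distrib]
      refine Finset.sum_eq_zero fun p _ => ?_
      rw [← Finset.sum_sub_distrib]
      refine (Finset.sum_congr rfl fun q _ => ?_).trans (hinv p)
      split_ifs <;> first | omega | simp
    have h2 : (2 : K) * S = 0 := by linear_combination -h0
    simpa using h2
  refine (Finset.sum_congr rfl fun i _ => Finset.sum_congr rfl fun j _ => ?_).trans hlt
  split_ifs with hij
  · exact hgoal i j hij
  · rfl

/-- **Statement 13.** Over a field of characteristic zero, for a finite-dimensional Lie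
algebra `L`, the form `c_n` is alternating and is a Chevalley–Eilenberg cocycle:
`Σ_{i<j} (−1)^{i+j} c_n(⁅x_i,x_j⁆, x₁,…,x̂_i,…,x̂_j,…,x_{2n}) = 0`. -/
theorem cForm_alternating_and_cocycle (K : Type*) [Field K] [CharZero K]
    (L : Type*) [LieRing L] [LieAlgebra K L] [Module.Finite K L]
    (n : ℕ) (hn : 1 ≤ n) :
    (∀ x : Fin (2 * n - 1) → L, ∀ i j : Fin (2 * n - 1), i ≠ j → x i = x j →
      cForm K L n x = 0) ∧
    (∀ x : Fin (2 * n) → L,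
      (∑ i : Fin (2 * n), ∑ j : Fin (2 * n),
        if (i : ℕ) < (j : ℕ) then
          ((-1 : K)) ^ ((i : ℕ) + (j : ℕ)) *
            cForm K L n (fun k =>
              (⁅x i, x j⁆ :: (((List.ofFn x).eraseIdx (j : ℕ)).eraseIdx (i : ℕ))).getD (k : ℕ) 0)
        else 0) = 0) := by
  refine ⟨fun x i j hij hx => ?_, ?_⟩
  · rw [cForm_eq_alternatization]
    exact AlternatingMap.map_eq_zero_of_eq _ x hx hij
  · obtain ⟨k, rfl⟩ : ∃ k, n = k + 1 := ⟨n - 1, by omega⟩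
    intro x
    simp only [cForm_eq_alternatization]
    exact AlternatingMap.sum_lie_eraseIdx_eq_zero (r := 2 * k)
      (MultilinearMap.alternatization (adTraceForm K L (2 * k + 1)))
      (sum_alternatization_adTraceForm_update_lie K L) x
end
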